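/- arXiv:2502.19792 — 2 statements merged into one kernel-verified Lean document; each statement's English description precedes it below -/
import Mathlib

section
/- Let 𝔅 be nonsingular, b ∈ ℝ^l, w = [x; y; z] = 𝔅^{-1}b, L ∈ ℝ^{k×l} with every entry of L·w nonzero; assume every entry of A, B, C, D, E and b is nonzero. For ε > 0 let S(ε) be the supremum of ‖ ( L(𝔅+Δ𝔅)^{-1}(b+Δb) − L𝔅^{-1}b ) / (L·w) ‖_∞ / ‖ [vec(A‡⊙ΔA); vec(B‡⊙ΔB); vec(C‡⊙ΔC); vec(D‡⊙ΔD); vec(E‡⊙ΔE); b‡⊙Δb] ‖_∞ (entrywise division in the numerator) over all perturbations ΔA, ΔB, ΔC, ΔD, ΔE, Δb of matching sizes for which Δ𝔅 = [[ΔA, ΔBᵀ, 0],[ΔB, −ΔD, ΔCᵀ],[0, ΔC, ΔE]] makes 𝔅+Δ𝔅 nonsingular and the perturbation measure in the denominator lies in (0, ε]. Then S(ε) tends, as ε → 0⁺, to the partial componentwise condition number ‖ ( |L·𝔅^{-1}·[𝒢, −I_l]| · [vec(|A|); vec(|B|); vec(|C|); vec(|D|); vec(|E|); |b|] ) / |L·w|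 ‖_∞, where the division is entrywise. -/
open Matrix Filter Topology

noncomputable section

/-- Index type for block vectors of sizes `n, m, p` (the paper's `l = n + m + p`). -/
abbrev Idx (n m p : ℕ) := Fin n ⊕ (Fin m ⊕ Fin p)

/-- Index type for the stacked vector `[vec A; vec B; vec C; vec D; vec E]`
(the paper's `s = n² + nm + mp + m² + p²`). -/
abbrev GIdx (n m p : ℕ) :=
  (Fin n × Fin n) ⊕ ((Fin n × Fin m) ⊕ ((Fin m × Fin p) ⊕ ((Fin m × Fin m) ⊕ (Fin p × Fin p))))

/-- Column-stacking vectorization of a `q × r` matrix: `vecC X (j, i) = X i j`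
(index = (column, row)). -/
def vecC {q r : ℕ} (X : Matrix (Fin q) (Fin r) ℝ) : Fin r × Fin q → ℝ := fun c => X c.2 c.1

/-- The double saddle point block matrix `[[A, Bᵀ, 0], [B, -D, Cᵀ], [0, C, E]]`. -/
def dsp {n m p : ℕ} (A : Matrix (Fin n) (Fin n) ℝ) (B : Matrix (Fin m) (Fin n) ℝ)
    (C : Matrix (Fin p) (Fin m) ℝ) (D : Matrix (Fin m) (Fin m) ℝ)
    (E : Matrix (Fin p) (Fin p) ℝ) : Matrix (Idx n m p) (Idx n m p) ℝ :=
  Matrix.of fun i j =>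
    match i, j with
    | Sum.inl i, Sum.inl j => A i j
    | Sum.inl i, Sum.inr (Sum.inl j) => Bᵀ i j
    | Sum.inl _, Sum.inr (Sum.inr _) => 0
    | Sum.inr (Sum.inl i), Sum.inl j => B i j
    | Sum.inr (Sum.inl i), Sum.inr (Sum.inl j) => -D i j
    | Sum.inr (Sum.inl i), Sum.inr (Sum.inr j) => Cᵀ i j
    | Sum.inr (Sum.inr _), Sum.inl _ => 0
    | Sum.inr (Sum.inr i), Sum.inr (Sum.inl j) => C i j
    | Sum.inr (Sum.inr i), Sum.inr (Sum.inr j) => E i j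

/-- The matrix `𝒢 = [[xᵀ⊗Iₙ, Iₙ⊗yᵀ, 0, 0, 0], [0, xᵀ⊗Iₘ, Iₘ⊗zᵀ, -(yᵀ⊗Iₘ), 0],
[0, 0, yᵀ⊗Iₚ, 0, zᵀ⊗Iₚ]] ∈ ℝ^{l×s}`, written entrywise with respect to the
column-stacking indices (so that `𝒢 ·ᵥ [vec ΔA; vec ΔB; vec ΔC; vec ΔD; vec ΔE]`
is exactly the action of the Kronecker-product block matrix of the paper). -/
def calG {n m p : ℕ} (x : Fin n → ℝ) (y : Fin m → ℝ) (z : Fin p → ℝ) :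
    Matrix (Idx n m p) (GIdx n m p) ℝ :=
  Matrix.of fun i c =>
    match i, c with
    | Sum.inl i, Sum.inl (j, i') => x j * (if i = i' then 1 else 0)
    | Sum.inl i, Sum.inr (Sum.inl (j, i')) => (if i = j then 1 else 0) * y i'
    | Sum.inl _, Sum.inr (Sum.inr (Sum.inl _)) => 0
    | Sum.inl _, Sum.inr (Sum.inr (Sum.inr (Sum.inl _))) => 0
    | Sum.inl _, Sum.inr (Sum.inr (Sum.inr (Sum.inr _))) => 0
    | Sum.inr (Sum.inl _), Sum.inl _ => 0
    | Sum.inr (Sum.inl i), Sum.inr (Sum.inl (j, i')) => x j * (if i = i' then 1 else 0)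
    | Sum.inr (Sum.inl i), Sum.inr (Sum.inr (Sum.inl (j, i'))) => (if i = j then 1 else 0) * z i'
    | Sum.inr (Sum.inl i), Sum.inr (Sum.inr (Sum.inr (Sum.inl (j, i')))) =>
        -(y j * (if i = i' then 1 else 0))
    | Sum.inr (Sum.inl _), Sum.inr (Sum.inr (Sum.inr (Sum.inr _))) => 0
    | Sum.inr (Sum.inr _), Sum.inl _ => 0
    | Sum.inr (Sum.inr _), Sum.inr (Sum.inl _) => 0
    | Sum.inr (Sum.inr i), Sum.inr (Sum.inr (Sum.inl (j, i'))) => y j * (if i = i' then 1 else 0)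
    | Sum.inr (Sum.inr _), Sum.inr (Sum.inr (Sum.inr (Sum.inl _))) => 0
    | Sum.inr (Sum.inr i), Sum.inr (Sum.inr (Sum.inr (Sum.inr (j, i')))) =>
        z j * (if i = i' then 1 else 0)

/-- The stacked vector `[vec A; vec B; vec C; vec D; vec E]`. -/
def vecG {n m p : ℕ} (A : Matrix (Fin n) (Fin n) ℝ) (B : Matrix (Fin m) (Fin n) ℝ)
    (C : Matrix (Fin p) (Fin m) ℝ) (D : Matrix (Fin m) (Fin m) ℝ)
    (E : Matrix (Fin p) (Fin p) ℝ) : GIdx n m p → ℝ :=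
  Sum.elim (vecC A) (Sum.elim (vecC B) (Sum.elim (vecC C) (Sum.elim (vecC D) (vecC E))))

/-- Euclidean norm of a vector. -/
def euclNorm {ι : Type*} [Fintype ι] (v : ι → ℝ) : ℝ := Real.sqrt (∑ i, v i ^ 2)

/-- Spectral norm (largest singular value = induced 2-norm) of a real matrix. -/
def specNorm {a b : Type*} [Fintype a] [Fintype b] (M : Matrix a b ℝ) : ℝ :=
  sSup {r : ℝ | ∃ v : b → ℝ, euclNorm v = 1 ∧ r = euclNorm (M.mulVec v)}

/-- Max-norm (`‖·‖_∞`) of a vector. -/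
def infNormV {ι : Type*} [Fintype ι] (v : ι → ℝ) : ℝ := ⨆ i, |v i|

/-- Induced ∞-norm of a matrix: the maximum absolute row sum. -/
def infNormM {a b : Type*} [Fintype a] [Fintype b] (M : Matrix a b ℝ) : ℝ :=
  ⨆ i, ∑ j, |M i j|

/-- Horizontal (block-column) concatenation `[M, N]`. -/
def hcat {a b c : Type*} (M : Matrix a b ℝ) (N : Matrix a c ℝ) : Matrix a (b ⊕ c) ℝ :=
  Matrix.of fun i => Sum.elim (M i) (N i)

/-- Entrywise absolute value of a matrix. -/
def absM {a b : Type*} (M : Matrix a b ℝ) : Matrix a b ℝ := Matrix.of fun i j => |M i j|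

/-- Entrywise absolute value of a vector. -/
def absV {ι : Type*} (v : ι → ℝ) : ι → ℝ := fun i => |v i|

/-- The matrix `𝒥 = [[(‖x‖₂²+‖y‖₂²)Iₙ, xyᵀ, 0], [yxᵀ, (‖x‖₂²+‖y‖₂²+‖z‖₂²)Iₘ, yzᵀ],
[0, zyᵀ, (‖y‖₂²+‖z‖₂²)Iₚ]]`. -/
def calJ {n m p : ℕ} (x : Fin n → ℝ) (y : Fin m → ℝ) (z : Fin p → ℝ) :
    Matrix (Idx n m p) (Idx n m p) ℝ :=
  Matrix.of fun i j =>
    match i, j with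
    | Sum.inl i, Sum.inl j => (euclNorm x ^ 2 + euclNorm y ^ 2) * (if i = j then 1 else 0)
    | Sum.inl i, Sum.inr (Sum.inl j) => x i * y j
    | Sum.inl _, Sum.inr (Sum.inr _) => 0
    | Sum.inr (Sum.inl i), Sum.inl j => y i * x j
    | Sum.inr (Sum.inl i), Sum.inr (Sum.inl j) =>
        (euclNorm x ^ 2 + euclNorm y ^ 2 + euclNorm z ^ 2) * (if i = j then 1 else 0)
    | Sum.inr (Sum.inl i), Sum.inr (Sum.inr j) => y i * z j
    | Sum.inr (Sum.inr _), Sum.inl _ => 0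
    | Sum.inr (Sum.inr i), Sum.inr (Sum.inl j) => z i * y j
    | Sum.inr (Sum.inr i), Sum.inr (Sum.inr j) =>
        (euclNorm y ^ 2 + euclNorm z ^ 2) * (if i = j then 1 else 0)

/-- The scaled perturbation vector
`[vec(Ψ_A‡⊙ΔA); vec(Ψ_B‡⊙ΔB); vec(Ψ_C‡⊙ΔC); vec(Ψ_D‡⊙ΔD); vec(Ψ_E‡⊙ΔE); χ‡⊙Δb]`
(for data with all entries nonzero, `v‡` is the entrywise reciprocal). -/
def scaledPert {n m p : ℕ} (ΨA : Matrix (Fin n) (Fin n) ℝ) (ΨB : Matrix (Fin m) (Fin n) ℝ)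
    (ΨC : Matrix (Fin p) (Fin m) ℝ) (ΨD : Matrix (Fin m) (Fin m) ℝ)
    (ΨE : Matrix (Fin p) (Fin p) ℝ) (χ : Idx n m p → ℝ)
    (ΔA : Matrix (Fin n) (Fin n) ℝ) (ΔB : Matrix (Fin m) (Fin n) ℝ)
    (ΔC : Matrix (Fin p) (Fin m) ℝ) (ΔD : Matrix (Fin m) (Fin m) ℝ)
    (ΔE : Matrix (Fin p) (Fin p) ℝ) (Δb : Idx n m p → ℝ) : GIdx n m p ⊕ Idx n m p → ℝ :=
  Sum.elim (fun c => (vecG ΨA ΨB ΨC ΨD ΨE c)⁻¹ * vecG ΔA ΔB ΔC ΔD ΔE c)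
    (fun i => (χ i)⁻¹ * Δb i)

/-- The vector `ℋ = [|A||x| + |B|ᵀ|y|; |B||x| + |D||y| + |C|ᵀ|z|; |C||y| + |E||z|]`. -/
def calH {n m p : ℕ} (A : Matrix (Fin n) (Fin n) ℝ) (B : Matrix (Fin m) (Fin n) ℝ)
    (C : Matrix (Fin p) (Fin m) ℝ) (D : Matrix (Fin m) (Fin m) ℝ)
    (E : Matrix (Fin p) (Fin p) ℝ) (x : Fin n → ℝ) (y : Fin m → ℝ) (z : Fin p → ℝ) :
    Idx n m p → ℝ :=
  Sum.elim ((absM A).mulVec (absV x) + (absM B)ᵀ.mulVec (absV y))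
    (Sum.elim
      ((absM B).mulVec (absV x) + (absM D).mulVec (absV y) + (absM C)ᵀ.mulVec (absV z))
      ((absM C).mulVec (absV y) + (absM E).mulVec (absV z)))

/-- Index type of the structured (generating-vector) parameter space
`[a; vec B; vec C; d; e]`. -/
abbrev SIdx (n m p s₁ r q : ℕ) :=
  Fin s₁ ⊕ (((Fin n × Fin m) ⊕ (Fin m × Fin p)) ⊕ (Fin r ⊕ Fin q))

/-- `Φ_S = blkdiag(Φ₁, I_{nm+mp}, Φ₂, Φ₃)`. -/
def PhiS {n m p s₁ r q : ℕ} (Φ₁ : Matrix (Fin n × Fin n) (Fin s₁) ℝ)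
    (Φ₂ : Matrix (Fin m × Fin m) (Fin r) ℝ) (Φ₃ : Matrix (Fin p × Fin p) (Fin q) ℝ) :
    Matrix (GIdx n m p) (SIdx n m p s₁ r q) ℝ :=
  Matrix.of fun i j =>
    match i, j with
    | Sum.inl i, Sum.inl j => Φ₁ i j
    | Sum.inr (Sum.inl i), Sum.inr (Sum.inl (Sum.inl j)) => if i = j then 1 else 0
    | Sum.inr (Sum.inr (Sum.inl i)), Sum.inr (Sum.inl (Sum.inr j)) => if i = j then 1 else 0
    | Sum.inr (Sum.inr (Sum.inr (Sum.inl i))), Sum.inr (Sum.inr (Sum.inl j)) => Φ₂ i j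
    | Sum.inr (Sum.inr (Sum.inr (Sum.inr i))), Sum.inr (Sum.inr (Sum.inr j)) => Φ₃ i j
    | _, _ => 0

/-- The structured scaled perturbation vector
`[ψ_A‡⊙Δa; vec(Ψ_B‡⊙ΔB); vec(Ψ_C‡⊙ΔC); ψ_D‡⊙Δd; ψ_E‡⊙Δe; χ‡⊙Δb]`. -/
def structPert {n m p s₁ r q : ℕ} (ψA : Fin s₁ → ℝ) (ΨB : Matrix (Fin m) (Fin n) ℝ)
    (ΨC : Matrix (Fin p) (Fin m) ℝ) (ψD : Fin r → ℝ) (ψE : Fin q → ℝ) (χ : Idx n m p → ℝ)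
    (Δa : Fin s₁ → ℝ) (ΔB : Matrix (Fin m) (Fin n) ℝ) (ΔC : Matrix (Fin p) (Fin m) ℝ)
    (Δd : Fin r → ℝ) (Δe : Fin q → ℝ) (Δb : Idx n m p → ℝ) :
    SIdx n m p s₁ r q ⊕ Idx n m p → ℝ :=
  Sum.elim
    (Sum.elim (fun j => (ψA j)⁻¹ * Δa j)
      (Sum.elim
        (Sum.elim (fun c => (vecC ΨB c)⁻¹ * vecC ΔB c) (fun c => (vecC ΨC c)⁻¹ * vecC ΔC c))
        (Sum.elim (fun j => (ψD j)⁻¹ * Δd j) (fun j => (ψE j)⁻¹ * Δe j))))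
    (fun i => (χ i)⁻¹ * Δb i)

/-- The EILS augmented matrix `𝔅̂ = [[0, 0, C], [0, J, M], [Cᵀ, Mᵀ, 0]]`
(block sizes `p, n, m`). -/
def eilsAug {n m p : ℕ} (J : Matrix (Fin n) (Fin n) ℝ) (M : Matrix (Fin n) (Fin m) ℝ)
    (C : Matrix (Fin p) (Fin m) ℝ) :
    Matrix (Fin p ⊕ (Fin n ⊕ Fin m)) (Fin p ⊕ (Fin n ⊕ Fin m)) ℝ :=
  Matrix.of fun i j =>
    match i, j with
    | Sum.inl i, Sum.inr (Sum.inr j) => C i j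
    | Sum.inr (Sum.inl i), Sum.inr (Sum.inl j) => J i j
    | Sum.inr (Sum.inl i), Sum.inr (Sum.inr j) => M i j
    | Sum.inr (Sum.inr i), Sum.inl j => Cᵀ i j
    | Sum.inr (Sum.inr i), Sum.inr (Sum.inl j) => Mᵀ i j
    | _, _ => 0

/-- The block permutation matrix `Σ = [[0, Iₙ, 0], [0, 0, Iₘ], [I_p, 0, 0]]`
(block rows of sizes `n, m, p`; block columns of sizes `p, n, m`). -/
def sigmaPerm (n m p : ℕ) : Matrix (Idx n m p) (Fin p ⊕ (Fin n ⊕ Fin m)) ℝ :=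
  Matrix.of fun i j =>
    match i, j with
    | Sum.inl i, Sum.inr (Sum.inl j) => if i = j then 1 else 0
    | Sum.inr (Sum.inl i), Sum.inr (Sum.inr j) => if i = j then 1 else 0
    | Sum.inr (Sum.inr i), Sum.inl j => if i = j then 1 else 0
    | _, _ => 0

/-- The matrix `𝒢̂ = [[yᵀ⊗Iₙ, 0], [Iₘ⊗xᵀ, Iₘ⊗zᵀ], [0, yᵀ⊗I_p]] ∈ ℝ^{l×m(n+p)}`,
written entrywise with respect to column-stacking indices of `[vec(ΔBᵀ); vec(ΔC)]`. -/
def hatG {n m p : ℕ} (x : Fin n → ℝ) (y : Fin m → ℝ) (z : Fin p → ℝ) :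
    Matrix (Idx n m p) ((Fin m × Fin n) ⊕ (Fin m × Fin p)) ℝ :=
  Matrix.of fun i c =>
    match i, c with
    | Sum.inl i, Sum.inl (j, i') => y j * (if i = i' then 1 else 0)
    | Sum.inl _, Sum.inr _ => 0
    | Sum.inr (Sum.inl i), Sum.inl (j, i') => (if i = j then 1 else 0) * x i'
    | Sum.inr (Sum.inl i), Sum.inr (j, i') => (if i = j then 1 else 0) * z i'
    | Sum.inr (Sum.inr _), Sum.inl _ => 0
    | Sum.inr (Sum.inr i), Sum.inr (j, i') => y j * (if i = i' then 1 else 0)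

theorem infNormV_eq_norm {ι : Type*} [Fintype ι] (v : ι → ℝ) : infNormV v = ‖v‖ := by
  refine le_antisymm (Real.iSup_le (fun i => norm_le_pi_norm v i) (norm_nonneg _)) ?_
  exact (pi_norm_le_iff_of_nonneg (Real.iSup_nonneg fun _ => abs_nonneg _)).2
    fun i => le_ciSup (f := fun i => |v i|) (Set.finite_range _).bddAbove i

theorem infNormM_nonneg {ι κ : Type*} [Fintype ι] [Fintype κ] (M : Matrix ι κ ℝ) :
    0 ≤ infNormM M :=
  Real.iSup_nonneg fun _ => Finset.sum_nonneg fun _ _ => abs_nonneg _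

theorem sum_abs_le_infNormM {ι κ : Type*} [Fintype ι] [Fintype κ] (M : Matrix ι κ ℝ) (i : ι) :
    ∑ j, |M i j| ≤ infNormM M :=
  le_ciSup (f := fun i => ∑ j, |M i j|) (Set.finite_range _).bddAbove i

theorem norm_mulVec_le_of_sum_abs_le {ι κ : Type*} [Fintype ι] [Fintype κ] {M : Matrix ι κ ℝ}
    {c : ℝ} (hc : 0 ≤ c) (h : ∀ i, ∑ j, |M i j| ≤ c) (v : κ → ℝ) : ‖M *ᵥ v‖ ≤ c * ‖v‖ := by
  refine (pi_norm_le_iff_of_nonneg (by positivity)).2 fun i => ?_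
  calc ‖(M *ᵥ v) i‖ ≤ ∑ j, ‖M i j * v j‖ := norm_sum_le _ _
    _ ≤ ∑ j, |M i j| * ‖v‖ := by
      refine Finset.sum_le_sum fun j _ => ?_
      rw [norm_mul, Real.norm_eq_abs]
      gcongr
      exact norm_le_pi_norm v j
    _ = (∑ j, |M i j|) * ‖v‖ := (Finset.sum_mul _ _ _).symm
    _ ≤ c * ‖v‖ := by gcongr; exact h i

theorem exists_norm_eq_one_infNormM_le {ι κ : Type*} [Fintype ι] [Fintype κ] [Nonempty κ]
    (M : Matrix ι κ ℝ) : ∃ v : κ → ℝ, ‖v‖ = 1 ∧ infNormM M ≤ ‖M *ᵥ v‖ := by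
  cases isEmpty_or_nonempty ι
  · exact ⟨1, norm_one, Real.iSup_le (fun i => isEmptyElim i) (norm_nonneg _)⟩
  obtain ⟨i, hi⟩ := exists_eq_ciSup_of_finite (f := fun i => ∑ j, |M i j|)
  have hs (j : κ) : ‖(if 0 ≤ M i j then 1 else -1 : ℝ)‖ = 1 := by split_ifs <;> simp
  refine ⟨fun j => if 0 ≤ M i j then 1 else -1, le_antisymm ?_ ?_, ?_⟩
  · exact (pi_norm_le_iff_of_nonneg zero_le_one).2 fun j => (hs j).le
  · obtain ⟨j⟩ := ‹Nonempty κ›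
    exact (hs j).ge.trans (norm_le_pi_norm (fun j => if 0 ≤ M i j then (1 : ℝ) else -1) j)
  · refine le_trans (le_trans (le_of_eq ?_) (le_abs_self _)) (norm_le_pi_norm (M *ᵥ _) i)
    rw [infNormM, ← hi]
    refine Finset.sum_congr rfl fun j _ => ?_
    dsimp only
    split_ifs with h
    · rw [abs_of_nonneg h, mul_one]
    · rw [abs_of_neg (not_le.1 h), mul_neg_one]

theorem tendsto_sSup_norm_mulVec_div {ι κ : Type*} [Fintype ι] [Fintype κ]
    {K : (κ → ℝ) → Matrix ι κ ℝ} {P : (κ → ℝ) → Prop} (hK : ContinuousAt K 0)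
    (hP : ∀ᶠ u in 𝓝 0, P u) :
    Tendsto (fun ε : ℝ => sSup {t : ℝ | ∃ u, P u ∧ 0 < ‖u‖ ∧ ‖u‖ ≤ ε ∧ t = ‖K u *ᵥ u‖ / ‖u‖})
      (𝓝[>] 0) (𝓝 (infNormM (K 0))) := by
  cases isEmpty_or_nonempty κ
  · have h0 (u : κ → ℝ) : ‖u‖ = 0 := by rw [Subsingleton.elim u 0, norm_zero]
    simp [h0, infNormM]
  refine Metric.tendsto_nhds.2 fun c hc => ?_
  have hclose : ∀ᶠ u in 𝓝 0, ∀ i, ∑ j, |(K u - K 0) i j| < c / 2 := by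
    refine eventually_all.2 fun i => ?_
    have hij (j : κ) : ContinuousAt (fun u => K u i j) 0 :=
      (continuous_id.matrix_elem i j).continuousAt.comp hK
    have : ContinuousAt (fun u => ∑ j, |(K u - K 0) i j|) 0 :=
      tendsto_finsetSum _ fun j _ => ((hij j).sub continuousAt_const).abs
    exact this.eventually_lt_const (by simpa using half_pos hc)
  obtain ⟨r, hr, hball⟩ := Metric.eventually_nhds_iff.1 (hclose.and hP)
  filter_upwards [Ioo_mem_nhdsGT hr] with ε hε
  have hdiff (u : κ → ℝ) (hu : ‖u‖ ≤ ε) (v : κ → ℝ) :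
      ‖K u *ᵥ v - K 0 *ᵥ v‖ ≤ c / 2 * ‖v‖ := by
    rw [← Matrix.sub_mulVec]
    refine norm_mulVec_le_of_sum_abs_le (half_pos hc).le (fun i => le_of_lt ?_) v
    exact (hball (by simpa using hu.trans_lt hε.2)).1 i
  have hupper : ∀ t ∈ {t : ℝ | ∃ u, P u ∧ 0 < ‖u‖ ∧ ‖u‖ ≤ ε ∧ t = ‖K u *ᵥ u‖ / ‖u‖},
      t ≤ infNormM (K 0) + c / 2 := by
    rintro t ⟨u, -, hu0, hu, rfl⟩
    rw [div_le_iff₀ hu0]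
    have h1 := norm_mulVec_le_of_sum_abs_le (infNormM_nonneg (K 0)) (sum_abs_le_infNormM _) u
    have h2 := norm_le_norm_add_norm_sub' (K u *ᵥ u) (K 0 *ᵥ u)
    linarith [hdiff u hu u]
  obtain ⟨v, hv, hMv⟩ := exists_norm_eq_one_infNormM_le (K 0)
  have hn : ‖ε • v‖ = ε := by rw [norm_smul, hv, mul_one, Real.norm_of_nonneg hε.1.le]
  have hmem : ‖K (ε • v) *ᵥ v‖ ∈
      {t : ℝ | ∃ u, P u ∧ 0 < ‖u‖ ∧ ‖u‖ ≤ ε ∧ t = ‖K u *ᵥ u‖ / ‖u‖} := by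
    refine ⟨ε • v, (hball (by simpa [hn] using hε.2)).2, hn.symm ▸ hε.1, hn.le, ?_⟩
    rw [hn, Matrix.mulVec_smul, norm_smul, Real.norm_of_nonneg hε.1.le,
      mul_div_cancel_left₀ _ hε.1.ne']
  have hle := csSup_le ⟨_, hmem⟩ hupper
  have hge := le_csSup ⟨_, hupper⟩ hmem
  have h1 := hdiff (ε • v) hn.le v
  have h2 := norm_le_norm_add_norm_sub (K (ε • v) *ᵥ v) (K 0 *ᵥ v)
  rw [hv] at h1
  rw [Real.dist_eq, abs_lt]
  constructor <;> linarith

/-- The double saddle point matrix assembled from the stacked vector of its blocks. -/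
def dspV {n m p : ℕ} (g : GIdx n m p → ℝ) : Matrix (Idx n m p) (Idx n m p) ℝ :=
  dsp (Matrix.of fun i j => g (Sum.inl (j, i))) (Matrix.of fun i j => g (Sum.inr (Sum.inl (j, i))))
    (Matrix.of fun i j => g (Sum.inr (Sum.inr (Sum.inl (j, i)))))
    (Matrix.of fun i j => g (Sum.inr (Sum.inr (Sum.inr (Sum.inl (j, i))))))
    (Matrix.of fun i j => g (Sum.inr (Sum.inr (Sum.inr (Sum.inr (j, i))))))

theorem exists_vecG_eq {n m p : ℕ} (g : GIdx n m p → ℝ) :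
    ∃ A B C D E, vecG A B C D E = g :=
  ⟨Matrix.of fun i j => g (Sum.inl (j, i)), Matrix.of fun i j => g (Sum.inr (Sum.inl (j, i))),
    Matrix.of fun i j => g (Sum.inr (Sum.inr (Sum.inl (j, i)))),
    Matrix.of fun i j => g (Sum.inr (Sum.inr (Sum.inr (Sum.inl (j, i))))),
    Matrix.of fun i j => g (Sum.inr (Sum.inr (Sum.inr (Sum.inr (j, i))))), by
      ext (_ | _ | _ | _ | _) <;> rfl⟩

theorem dspV_vecG {n m p : ℕ} (A : Matrix (Fin n) (Fin n) ℝ) (B : Matrix (Fin m) (Fin n) ℝ)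
    (C : Matrix (Fin p) (Fin m) ℝ) (D : Matrix (Fin m) (Fin m) ℝ)
    (E : Matrix (Fin p) (Fin p) ℝ) : dspV (vecG A B C D E) = dsp A B C D E :=
  rfl

theorem dspV_zero {n m p : ℕ} : dspV (0 : GIdx n m p → ℝ) = 0 := by
  ext (_ | _ | _) (_ | _ | _) <;> simp [dspV, dsp]

theorem continuous_dspV {n m p : ℕ} : Continuous (dspV : (GIdx n m p → ℝ) → _) := by
  refine continuous_matrix fun i j => ?_
  rcases i with _ | _ | _ <;> rcases j with _ | _ | _ <;> simp only [dspV, dsp, Matrix.of_apply,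
    Matrix.transpose_apply] <;> fun_prop

theorem dsp_mulVec {n m p : ℕ} (A : Matrix (Fin n) (Fin n) ℝ) (B : Matrix (Fin m) (Fin n) ℝ)
    (C : Matrix (Fin p) (Fin m) ℝ) (D : Matrix (Fin m) (Fin m) ℝ) (E : Matrix (Fin p) (Fin p) ℝ)
    (x : Fin n → ℝ) (y : Fin m → ℝ) (z : Fin p → ℝ) :
    dsp A B C D E *ᵥ Sum.elim x (Sum.elim y z) = calG x y z *ᵥ vecG A B C D E := by
  ext (i | i | i) <;>
    simp [Matrix.mulVec, dotProduct, dsp, calG, vecG, vecC, Fintype.sum_sum_type,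
      Fintype.sum_prod_type, mul_comm]
  exact add_comm _ _

theorem hcat_mulVec {a b c : Type*} [Fintype b] [Fintype c] (M : Matrix a b ℝ) (N : Matrix a c ℝ)
    (v : b → ℝ) (w : c → ℝ) : hcat M N *ᵥ Sum.elim v w = M *ᵥ v + N *ᵥ w := by
  ext i
  simp [Matrix.mulVec, dotProduct, hcat]

theorem inv_mulVec_sub_inv_mulVec {ι : Type*} [Fintype ι] [DecidableEq ι] {M N : Matrix ι ι ℝ}
    (hM : IsUnit M.det) (hMN : IsUnit (M + N).det) (b c : ι → ℝ) :
    (M + N)⁻¹ *ᵥ (b + c) - M⁻¹ *ᵥ b = (M + N)⁻¹ *ᵥ (c - N *ᵥ (M⁻¹ *ᵥ b)) := by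
  have h : M⁻¹ *ᵥ b = (M + N)⁻¹ *ᵥ ((M + N) *ᵥ (M⁻¹ *ᵥ b)) := by
    rw [Matrix.mulVec_mulVec _ (M + N)⁻¹, Matrix.nonsing_inv_mul _ hMN, Matrix.one_mulVec]
  have h2 : M *ᵥ (M⁻¹ *ᵥ b) = b := by
    rw [Matrix.mulVec_mulVec, Matrix.mul_nonsing_inv _ hM, Matrix.one_mulVec]
  conv_lhs => rw [h]
  rw [← Matrix.mulVec_sub, Matrix.add_mulVec, h2]
  congr 1
  abel

/-- partial componentwise condition number, eq. (3.9). -/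
theorem stmt9 {n m p k : ℕ}
    (A : Matrix (Fin n) (Fin n) ℝ) (B : Matrix (Fin m) (Fin n) ℝ) (C : Matrix (Fin p) (Fin m) ℝ)
    (D : Matrix (Fin m) (Fin m) ℝ) (E : Matrix (Fin p) (Fin p) ℝ)
    (hB : IsUnit (dsp A B C D E).det) (b : Idx n m p → ℝ)
    (x : Fin n → ℝ) (y : Fin m → ℝ) (z : Fin p → ℝ)
    (hw : Sum.elim x (Sum.elim y z) = ((dsp A B C D E)⁻¹).mulVec b)
    (L : Matrix (Fin k) (Idx n m p) ℝ)
    (hLw : ∀ i, L.mulVec (Sum.elim x (Sum.elim y z)) i ≠ 0)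
    (hA : ∀ i j, A i j ≠ 0) (hb : ∀ i j, B i j ≠ 0) (hC : ∀ i j, C i j ≠ 0)
    (hD : ∀ i j, D i j ≠ 0) (hE : ∀ i j, E i j ≠ 0) (hbv : ∀ i, b i ≠ 0) :
    Tendsto (fun ε : ℝ => sSup {t : ℝ |
        ∃ (ΔA : Matrix (Fin n) (Fin n) ℝ) (ΔB : Matrix (Fin m) (Fin n) ℝ)
          (ΔC : Matrix (Fin p) (Fin m) ℝ) (ΔD : Matrix (Fin m) (Fin m) ℝ)
          (ΔE : Matrix (Fin p) (Fin p) ℝ) (Δb : Idx n m p → ℝ),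
          IsUnit (dsp A B C D E + dsp ΔA ΔB ΔC ΔD ΔE).det ∧
          0 < infNormV (scaledPert A B C D E b ΔA ΔB ΔC ΔD ΔE Δb) ∧
          infNormV (scaledPert A B C D E b ΔA ΔB ΔC ΔD ΔE Δb) ≤ ε ∧
          t = infNormV (fun i =>
                (L.mulVec (((dsp A B C D E + dsp ΔA ΔB ΔC ΔD ΔE)⁻¹).mulVec (b + Δb)) i
                    - L.mulVec (((dsp A B C D E)⁻¹).mulVec b) i) /
                  L.mulVec (Sum.elim x (Sum.elim y z)) i) /
              infNormV (scaledPert A B C D E b ΔA ΔB ΔC ΔD ΔE Δb)})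
      (𝓝[>] 0)
      (𝓝 (infNormV (fun i =>
          ((absM (L * (dsp A B C D E)⁻¹ *
              hcat (calG x y z) (-1 : Matrix (Idx n m p) (Idx n m p) ℝ))).mulVec
            (Sum.elim (vecG (absM A) (absM B) (absM C) (absM D) (absM E)) (absV b))) i /
          |L.mulVec (Sum.elim x (Sum.elim y z)) i|))) := by
  have hw' := hw.symm
  set w := Sum.elim x (Sum.elim y z) with hwdef
  set M := dsp A B C D E with hM
  set d : GIdx n m p ⊕ Idx n m p → ℝ := Sum.elim (vecG A B C D E) b with hd
  have hd0 (j) : d j ≠ 0 := by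
    rcases j with (⟨i, j⟩ | ⟨i, j⟩ | ⟨i, j⟩ | ⟨i, j⟩ | ⟨i, j⟩) | i
    exacts [hA _ _, hb _ _, hC _ _, hD _ _, hE _ _, hbv _]
  set Δ : (GIdx n m p ⊕ Idx n m p → ℝ) → Matrix (Idx n m p) (Idx n m p) ℝ :=
    fun u => dspV fun c => d (Sum.inl c) * u (Sum.inl c) with hΔ
  set K : (GIdx n m p ⊕ Idx n m p → ℝ) → Matrix (Fin k) (GIdx n m p ⊕ Idx n m p) ℝ :=
    fun u => Matrix.of fun i j => -((L * (M + Δ u)⁻¹ * hcat (calG x y z) (-1)) i j * d j) /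
      (L *ᵥ w) i with hKdef
  have hΔ0 : Δ 0 = 0 := by
    simp only [hΔ, Pi.zero_apply, mul_zero]
    exact dspV_zero
  have hΔc : Continuous Δ := continuous_dspV.comp (by fun_prop)
  have hinv : ContinuousAt (fun u => (M + Δ u)⁻¹) 0 := by
    refine ContinuousAt.comp (g := Inv.inv) (continuousAt_matrix_inv _ ?_)
      (continuous_const.add hΔc).continuousAt
    rw [hΔ0, add_zero, Ring.inverse_eq_inv']
    exact continuousAt_inv₀ hB.ne_zero
  have hK : ContinuousAt K 0 := by
    have hprod : ContinuousAt (fun u => L * (M + Δ u)⁻¹ * hcat (calG x y z) (-1)) 0 :=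
      ContinuousAt.comp (f := fun u => (M + Δ u)⁻¹)
        (g := fun N => L * N * hcat (calG x y z) (-1 : Matrix (Idx n m p) (Idx n m p) ℝ))
        ((continuous_const.matrix_mul continuous_id).matrix_mul continuous_const).continuousAt hinv
    refine continuousAt_pi.2 fun i => continuousAt_pi.2 fun j => ?_
    have hij : ContinuousAt (fun u => (L * (M + Δ u)⁻¹ * hcat (calG x y z) (-1)) i j) 0 :=
      (continuous_id.matrix_elem i j).continuousAt.comp hprod
    exact (hij.mul continuousAt_const).neg.div_const _
  have hP : ∀ᶠ u in 𝓝 0, IsUnit (M + Δ u).det := by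
    have hdet : ContinuousAt (fun u => (M + Δ u).det) 0 :=
      (continuous_const.add hΔc).matrix_det.continuousAt
    refine (hdet.eventually_ne ?_).mono fun u hu => isUnit_iff_ne_zero.2 hu
    rw [hΔ0, add_zero]
    exact hB.ne_zero
  have hKu (u) (hu : IsUnit (M + Δ u).det) (Δb : Idx n m p → ℝ)
      (hΔb : Δb = fun i => d (Sum.inr i) * u (Sum.inr i)) :
      (fun i => ((L *ᵥ ((M + Δ u)⁻¹ *ᵥ (b + Δb))) i - (L *ᵥ (M⁻¹ *ᵥ b)) i) / (L *ᵥ w) i)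
        = K u *ᵥ u := by
    have hN : Δ u *ᵥ w = calG x y z *ᵥ fun c => d (Sum.inl c) * u (Sum.inl c) := by
      obtain ⟨ΔA, ΔB, ΔC, ΔD, ΔE, h⟩ := exists_vecG_eq fun c => d (Sum.inl c) * u (Sum.inl c)
      simp only [hΔ]
      rw [← h, dspV_vecG, hwdef, dsp_mulVec]
    have hs : Δb - Δ u *ᵥ w = -(hcat (calG x y z) (-1) *ᵥ fun j => d j * u j) := by
      have : (fun j => d j * u j) = Sum.elim (fun c => d (Sum.inl c) * u (Sum.inl c)) Δb := by
        ext (_ | _) <;> simp [hΔb]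
      rw [this, hcat_mulVec, hN, Matrix.neg_mulVec, Matrix.one_mulVec]
      abel
    ext i
    rw [← Pi.sub_apply, ← Matrix.mulVec_sub, inv_mulVec_sub_inv_mulVec hB hu, hw', hs,
      Matrix.mulVec_neg, Matrix.mulVec_neg, Matrix.mulVec_mulVec, Matrix.mulVec_mulVec]
    simp only [hKdef, Matrix.mulVec, dotProduct, Matrix.of_apply, Pi.neg_apply]
    rw [← Finset.sum_neg_distrib, Finset.sum_div]
    refine Finset.sum_congr rfl fun j _ => ?_
    ring
  have hlim : infNormM (K 0) = infNormV (fun i =>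
      ((absM (L * M⁻¹ * hcat (calG x y z) (-1 : Matrix (Idx n m p) (Idx n m p) ℝ))).mulVec
        (Sum.elim (vecG (absM A) (absM B) (absM C) (absM D) (absM E)) (absV b))) i /
          |(L *ᵥ w) i|) := by
    have habs : Sum.elim (vecG (absM A) (absM B) (absM C) (absM D) (absM E)) (absV b) =
        fun j => |d j| := by
      ext ((_ | _ | _ | _ | _) | _) <;> rfl
    rw [habs, infNormM, infNormV]
    refine iSup_congr fun i => ?_
    rw [abs_of_nonneg (div_nonneg (Finset.sum_nonneg fun _ _ =>
      mul_nonneg (abs_nonneg _) (abs_nonneg _)) (abs_nonneg _))]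
    simp only [hKdef, hΔ0, add_zero, Matrix.mulVec, dotProduct, Matrix.of_apply, absM, abs_div,
      abs_neg, abs_mul, Finset.sum_div]
  rw [← hlim]
  refine (tendsto_sSup_norm_mulVec_div hK hP).congr fun ε => congrArg sSup (Set.ext fun t => ?_)
  simp only [infNormV_eq_norm]
  constructor
  · rintro ⟨u, hu, h0, hε, rfl⟩
    obtain ⟨ΔA, ΔB, ΔC, ΔD, ΔE, h⟩ := exists_vecG_eq fun c => d (Sum.inl c) * u (Sum.inl c)
    have hdsp : dsp ΔA ΔB ΔC ΔD ΔE = Δ u := by rw [← dspV_vecG, h]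
    have hpert : scaledPert A B C D E b ΔA ΔB ΔC ΔD ΔE
        (fun i => d (Sum.inr i) * u (Sum.inr i)) = u := by
      ext (c | i)
      · simpa [scaledPert, h, hd] using inv_mul_cancel_left₀ (hd0 (Sum.inl c)) (u (Sum.inl c))
      · exact inv_mul_cancel_left₀ (hd0 (Sum.inr i)) _
    refine ⟨ΔA, ΔB, ΔC, ΔD, ΔE, fun i => d (Sum.inr i) * u (Sum.inr i), ?_⟩
    rw [hpert, hdsp, hKu u hu _ rfl]
    exact ⟨hu, h0, hε, rfl⟩
  · rintro ⟨ΔA, ΔB, ΔC, ΔD, ΔE, Δb, hu, h0, hε, rfl⟩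
    set u := scaledPert A B C D E b ΔA ΔB ΔC ΔD ΔE Δb with hudef
    have hdsp : dsp ΔA ΔB ΔC ΔD ΔE = Δ u := by
      rw [← dspV_vecG]
      exact congrArg dspV (funext fun c => (mul_inv_cancel_left₀ (hd0 (Sum.inl c)) _).symm)
    have hΔb : Δb = fun i => d (Sum.inr i) * u (Sum.inr i) :=
      funext fun i => (mul_inv_cancel_left₀ (hd0 (Sum.inr i)) _).symm
    rw [hdsp] at hu ⊢
    exact ⟨u, hu, h0, hε, by rw [hKu u hu _ hΔb]⟩

end
end

section
/- Let 𝔅 be nonsingular, b ∈ ℝ^l, w = [x; y; z] = 𝔅^{-1}b, and L ∈ ℝ^{k×l} with every entry of L·w nonzero. Then ‖ ( |L·𝔅^{-1}·[𝒢, −I_l]| · [vec(|A|); vec(|B|); vec(|C|); vec(|D|); vec(|E|); |b|] ) / |L·w| ‖_∞ ≤ ‖ ( |L·𝔅^{-1}| · ( ℋ + |b| ) ) / |L·w| ‖_∞, where the divisions are entrywise and ℋ = [ |A|·|x| + |B|ᵀ·|y| ; |B|·|x| + |D|·|y| + |C|ᵀ·|z| ; |C|·|y| + |E|·|z| ] ∈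 ℝ^l. -/
open Matrix Filter Topology

noncomputable section

lemma absM_mul_mulVec_le {a b c : Type*} [Fintype b] [Fintype c] (M : Matrix a b ℝ)
    (N : Matrix b c ℝ) {v : c → ℝ} (hv : ∀ j, 0 ≤ v j) (i : a) :
    (absM (M * N)).mulVec v i ≤ (absM M).mulVec ((absM N).mulVec v) i := by
  rw [Matrix.mulVec_mulVec]
  refine Finset.sum_le_sum fun j _ => mul_le_mul_of_nonneg_right ?_ (hv j)
  simp only [absM, Matrix.mul_apply, Matrix.of_apply, ← abs_mul]
  exact Finset.abs_sum_le_sum_abs _ _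

lemma absM_mulVec_nonneg {a b : Type*} [Fintype b] (M : Matrix a b ℝ) {v : b → ℝ}
    (hv : ∀ j, 0 ≤ v j) (i : a) : 0 ≤ (absM M).mulVec v i :=
  Finset.sum_nonneg fun j _ => mul_nonneg (abs_nonneg _) (hv j)

lemma vecG_absM_nonneg {n m p : ℕ} (A : Matrix (Fin n) (Fin n) ℝ) (B : Matrix (Fin m) (Fin n) ℝ)
    (C : Matrix (Fin p) (Fin m) ℝ) (D : Matrix (Fin m) (Fin m) ℝ) (E : Matrix (Fin p) (Fin p) ℝ)
    (c : GIdx n m p) : 0 ≤ vecG (absM A) (absM B) (absM C) (absM D) (absM E) c := by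
  rcases c with c | c | c | c | c <;> exact abs_nonneg _

lemma absM_calG_mulVec_vecG {n m p : ℕ} (A : Matrix (Fin n) (Fin n) ℝ)
    (B : Matrix (Fin m) (Fin n) ℝ) (C : Matrix (Fin p) (Fin m) ℝ) (D : Matrix (Fin m) (Fin m) ℝ)
    (E : Matrix (Fin p) (Fin p) ℝ) (x : Fin n → ℝ) (y : Fin m → ℝ) (z : Fin p → ℝ) :
    (absM (calG x y z)).mulVec (vecG (absM A) (absM B) (absM C) (absM D) (absM E)) =
      calH A B C D E x y z := by
  ext i
  rcases i with i | i | i <;>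
    simp [absM, calG, vecG, vecC, calH, absV, Matrix.mulVec, dotProduct, Fintype.sum_sum_type,
      Fintype.sum_prod_type, mul_comm, add_assoc, apply_ite abs, Finset.sum_ite_irrel]
  exact add_comm _ _

lemma absM_hcat_neg_one_mulVec {a c : Type*} [Fintype a] [DecidableEq a] [Fintype c]
    (M : Matrix a c ℝ) (v : c → ℝ) (w : a → ℝ) :
    (absM (hcat M (-1 : Matrix a a ℝ))).mulVec (Sum.elim v w) = (absM M).mulVec v + w := by
  have h (i j : a) : |(1 : Matrix a a ℝ) i j| = (1 : Matrix a a ℝ) i j := by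
    rw [Matrix.one_apply]; split_ifs <;> simp
  ext i
  have := congrFun (Matrix.one_mulVec w) i
  simp only [Matrix.mulVec, dotProduct] at this
  simp [absM, hcat, Matrix.mulVec, dotProduct, Fintype.sum_sum_type, h, this]

lemma infNormV_mono {ι : Type*} [Fintype ι] {u v : ι → ℝ} (h : ∀ i, |u i| ≤ |v i|) :
    infNormV u ≤ infNormV v :=
  ciSup_mono (Set.finite_range _).bddAbove h

/-- Corollary 3.2, componentwise upper bound. -/
theorem stmt12 {n m p k : ℕ}
    (A : Matrix (Fin n) (Fin n) ℝ) (B : Matrix (Fin m) (Fin n) ℝ) (C : Matrix (Fin p) (Fin m) ℝ)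
    (D : Matrix (Fin m) (Fin m) ℝ) (E : Matrix (Fin p) (Fin p) ℝ)
    (hB : IsUnit (dsp A B C D E).det) (b : Idx n m p → ℝ)
    (x : Fin n → ℝ) (y : Fin m → ℝ) (z : Fin p → ℝ)
    (hw : Sum.elim x (Sum.elim y z) = ((dsp A B C D E)⁻¹).mulVec b)
    (L : Matrix (Fin k) (Idx n m p) ℝ)
    (hLw : ∀ i, L.mulVec (Sum.elim x (Sum.elim y z)) i ≠ 0) :
    infNormV (fun i =>
        ((absM (L * (dsp A B C D E)⁻¹ *
            hcat (calG x y z) (-1 : Matrix (Idx n m p) (Idx n m p) ℝ))).mulVec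
          (Sum.elim (vecG (absM A) (absM B) (absM C) (absM D) (absM E)) (absV b))) i /
        |L.mulVec (Sum.elim x (Sum.elim y z)) i|) ≤
      infNormV (fun i =>
        ((absM (L * (dsp A B C D E)⁻¹)).mulVec (calH A B C D E x y z + absV b)) i /
        |L.mulVec (Sum.elim x (Sum.elim y z)) i|) := by
  have hv : ∀ c, 0 ≤ (Sum.elim (vecG (absM A) (absM B) (absM C) (absM D) (absM E)) (absV b)) c := by
    rintro (c | c)
    · exact vecG_absM_nonneg A B C D E c
    · exact abs_nonneg _
  refine infNormV_mono fun i => ?_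
  refine abs_le_abs_of_nonneg (div_nonneg (absM_mulVec_nonneg _ hv i) (abs_nonneg _)) ?_
  refine div_le_div_of_nonneg_right ?_ (abs_nonneg _)
  refine (absM_mul_mulVec_le _ _ hv i).trans_eq ?_
  rw [absM_hcat_neg_one_mulVec, absM_calG_mulVec_vecG]

end
end
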